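/- arXiv:2106.07468 — 4 statements merged into one kernel-verified Lean document; each statement's English description precedes it below -/
import Mathlib

section
/- Under the Hermite-spectral Vlasov–Poisson system, the total momentum is conserved: for all t ≥ 0, (d/dt) ∫₀ᴸ C₁(t,x)/α(t) dx = 0. -/
open MeasureTheory Real

/-- The partial derivative of a `C¹` function in its first variable is a value of its
Fréchet derivative. -/
lemma ContDiff.hasDerivAt_fst {f : ℝ → ℝ → ℝ}
    (hf : ContDiff ℝ 1 (fun p : ℝ × ℝ => f p.1 p.2)) (t x : ℝ) :
    HasDerivAt (fun τ => f τ x) (fderiv ℝ (fun p : ℝ × ℝ => f p.1 p.2) (t, x) (1, 0)) t :=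
  HasFDerivAt.comp_hasDerivAt (f := fun τ => (τ, x)) t
    (hf.differentiable one_ne_zero (t, x)).hasFDerivAt
    ((hasDerivAt_id t).prodMk (hasDerivAt_const t x))

/-- A `C¹` function of two variables is differentiable in its second variable. -/
lemma ContDiff.hasDerivAt_deriv_snd {f : ℝ → ℝ → ℝ}
    (hf : ContDiff ℝ 1 (fun p : ℝ × ℝ => f p.1 p.2)) (t x : ℝ) :
    HasDerivAt (fun y => f t y) (deriv (fun y => f t y) x) x :=
  (((hf.differentiable one_ne_zero (t, x)).hasFDerivAt).comp_hasDerivAt x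
    ((hasDerivAt_const x t).prodMk (hasDerivAt_id x))).differentiableAt.hasDerivAt

/-- The partial derivative of a `C¹` function in its first variable is jointly continuous. -/
lemma ContDiff.continuous_deriv_fst {f : ℝ → ℝ → ℝ}
    (hf : ContDiff ℝ 1 (fun p : ℝ × ℝ => f p.1 p.2)) :
    Continuous (fun p : ℝ × ℝ => deriv (fun τ => f τ p.2) p.1) := by
  have h : (fun p : ℝ × ℝ => deriv (fun τ => f τ p.2) p.1) =
      fun p => fderiv ℝ (fun p : ℝ × ℝ => f p.1 p.2) p (1, 0) :=
    funext fun p => (hf.hasDerivAt_fst p.1 p.2).deriv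
  rw [h]
  exact (hf.continuous_fderiv one_ne_zero).clm_apply continuous_const

/-- Differentiation under the integral sign for a `C¹` integrand on a compact interval. -/
lemma ContDiff.hasDerivAt_intervalIntegral {f : ℝ → ℝ → ℝ}
    (hf : ContDiff ℝ 1 (fun p : ℝ × ℝ => f p.1 p.2)) (a b t : ℝ) :
    HasDerivAt (fun τ => ∫ x in a..b, f τ x) (∫ x in a..b, deriv (fun τ => f τ x) t) t := by
  have hd := hf.continuous_deriv_fst
  have hslice (τ : ℝ) : Continuous (fun x => f τ x) :=
    hf.continuous.comp (by fun_prop : Continuous fun x : ℝ => (τ, x))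
  have hdslice : Continuous (fun x => deriv (fun τ => f τ x) t) :=
    hd.comp (by fun_prop : Continuous fun x : ℝ => (t, x))
  obtain ⟨M, hM⟩ := ((isCompact_closedBall t 1).prod (isCompact_uIcc (a := a) (b := b))
    ).exists_bound_of_continuousOn hd.continuousOn
  refine (intervalIntegral.hasDerivAt_integral_of_dominated_loc_of_deriv_le
    (F' := fun τ x => deriv (fun τ => f τ x) τ) (bound := fun _ => M)
    (Metric.closedBall_mem_nhds t one_pos)
    (Filter.Eventually.of_forall fun τ => (hslice τ).aestronglyMeasurable)
    ((hslice t).intervalIntegrable a b) hdslice.aestronglyMeasurable ?_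
    intervalIntegrable_const ?_).2
  · exact Filter.Eventually.of_forall fun x hx τ hτ =>
      hM (τ, x) ⟨hτ, Set.uIoc_subset_uIcc hx⟩
  · exact Filter.Eventually.of_forall fun x _ τ _ =>
      (hf.hasDerivAt_fst τ x).differentiableAt.hasDerivAt

/-- Conservation of momentum for the Hermite-spectral Vlasov–Poisson system. -/
theorem hermite_momentum_conservation
    (N_H : ℕ) (hNH : 3 ≤ N_H)
    (L α₀ γ ρ₀ : ℝ) (hL : 0 < L) (hα₀ : 0 < α₀) (hγ : 0 < γ)
    (C : ℤ → ℝ → ℝ → ℝ) (Φ E : ℝ → ℝ → ℝ) (α αd Esup : ℝ → ℝ)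
    -- the Cₙ are C¹ and L-periodic in x, with Cₙ ≡ 0 for n < 0 and n ≥ N_H
    (hC1 : ∀ n : ℤ, ContDiff ℝ 1 (fun p : ℝ × ℝ => C n p.1 p.2))
    (hCper : ∀ (n : ℤ) (t x : ℝ), C n t (x + L) = C n t x)
    (hCneg : ∀ n : ℤ, n < 0 → C n = 0)
    (hCbig : ∀ n : ℤ, (N_H : ℤ) ≤ n → C n = 0)
    -- Φ, E are C¹ and L-periodic in x, with E = -∂ₓΦ and ∂ₓE = C₀ - ρ₀
    (hΦ1 : ContDiff ℝ 1 (fun p : ℝ × ℝ => Φ p.1 p.2))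
    (hE1 : ContDiff ℝ 1 (fun p : ℝ × ℝ => E p.1 p.2))
    (hΦper : ∀ t x : ℝ, Φ t (x + L) = Φ t x)
    (hEper : ∀ t x : ℝ, E t (x + L) = E t x)
    (hEΦ : ∀ t x : ℝ, E t x = - deriv (fun y => Φ t y) x)
    (hPoisson : ∀ t x : ℝ, deriv (fun y => E t y) x = C 0 t x - ρ₀)
    -- the sup norm in x of E, assumed continuous in t
    (hEsup : ∀ t, Esup t = ⨆ x : ℝ, |E t x|)
    (hEbdd : ∀ t, BddAbove (Set.range fun x : ℝ => |E t x|))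
    (hEsupCont : Continuous Esup)
    -- the scaling function α and its derivative α' = -(γ/2) ‖E‖_∞² α³
    (hα : ∀ t, α t = α₀ / Real.sqrt (1 + γ * ∫ s in (0:ℝ)..t, (Esup s) ^ 2))
    (hαd : ∀ t, αd t = -(γ / 2) * (Esup t) ^ 2 * (α t) ^ 3)
    (hαderiv : ∀ t, 0 ≤ t → HasDerivAt α (αd t) t)
    -- the Hermite-spectral Vlasov system
    (hVlasov : ∀ n : ℤ, 0 ≤ n → n < (N_H : ℤ) → ∀ t x : ℝ, 0 ≤ t →
      deriv (fun τ => C n τ x) t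
        - (αd t / α t) * ((n : ℝ) * C n t x + Real.sqrt (((n : ℝ) - 1) * (n : ℝ)) * C (n - 2) t x)
        + (1 / α t) * (Real.sqrt (n : ℝ) * deriv (fun y => C (n - 1) t y) x
            + Real.sqrt ((n : ℝ) + 1) * deriv (fun y => C (n + 1) t y) x)
        - α t * Real.sqrt (n : ℝ) * E t x * C (n - 1) t x = 0) :
    ∀ t, 0 ≤ t → HasDerivAt (fun τ => ∫ x in (0:ℝ)..L, C 1 τ x / α τ) 0 t := by
  intro t ht
  have hαt : α t ≠ 0 := by
    have hint : 0 ≤ ∫ s in (0:ℝ)..t, (Esup s) ^ 2 :=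
      intervalIntegral.integral_nonneg ht fun s _ => sq_nonneg _
    have hpos : 0 < 1 + γ * ∫ s in (0:ℝ)..t, (Esup s) ^ 2 := by positivity
    rw [hα t]
    exact (div_pos hα₀ (Real.sqrt_pos.2 hpos)).ne'
  have hC1cont : Continuous (fun x => C 1 t x) :=
    (hC1 1).continuous.comp (by fun_prop : Continuous fun x : ℝ => (t, x))
  have hdcont : Continuous (fun x => deriv (fun τ => C 1 τ x) t) :=
    (hC1 1).continuous_deriv_fst.comp (by fun_prop : Continuous fun x : ℝ => (t, x))
  -- up to the dilation term, the time derivative of `C₁` is an exact `x`-derivative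
  have hflux (x : ℝ) : HasDerivAt
      (fun y => α t * (E t y ^ 2 / 2 - ρ₀ * Φ t y) - (1 / α t) * (C 0 t y + √2 * C 2 t y))
      (deriv (fun τ => C 1 τ x) t - αd t / α t * C 1 t x) x := by
    have hE := hE1.hasDerivAt_deriv_snd t x
    have hΦ := hΦ1.hasDerivAt_deriv_snd t x
    have h0 := (hC1 0).hasDerivAt_deriv_snd t x
    have h2 := (hC1 2).hasDerivAt_deriv_snd t x
    refine (((((hE.pow 2).div_const 2).sub (hΦ.const_mul ρ₀)).const_mul (α t)).sub
      ((h0.add (h2.const_mul √2)).const_mul (1 / α t))).congr_deriv ?_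
    have hV := hVlasov 1 (by norm_num) (by omega) t x ht
    norm_num at hV
    have hP := hPoisson t x
    have hEx := hEΦ t x
    have hΦx : deriv (fun y => Φ t y) x = -E t x := by linarith
    rw [hP, hΦx]
    norm_num
    linear_combination -hV
  have hzero : ∫ x in (0:ℝ)..L, (deriv (fun τ => C 1 τ x) t - αd t / α t * C 1 t x) = 0 := by
    rw [intervalIntegral.integral_eq_sub_of_hasDerivAt (fun x _ => hflux x)
      ((hdcont.sub (hC1cont.const_mul _)).intervalIntegrable 0 L)]
    have hE := hEper t 0
    have hΦ := hΦper t 0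
    have h0 := hCper 0 t 0
    have h2 := hCper 2 t 0
    rw [zero_add] at hE hΦ h0 h2
    rw [hE, hΦ, h0, h2, sub_self]
  rw [intervalIntegral.integral_sub (hdcont.intervalIntegrable 0 L)
    ((hC1cont.const_mul _).intervalIntegrable 0 L),
    intervalIntegral.integral_const_mul, sub_eq_zero] at hzero
  simp only [intervalIntegral.integral_div]
  refine (((hC1 1).hasDerivAt_intervalIntegral 0 L t).div (hαderiv t ht) hαt).congr_deriv ?_
  rw [hzero]
  field_simp
  ring
end

section
/- Under the Hermite-spectral Vlasov–Poisson system, the total energy is conserved: the function t ↦ (1/2) ∫₀ᴸ [ α(t)^{−2} (√2 C₂(t,x) + C₀(t,x)) + E(t,x)² ] dx is constant on [0,∞). -/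
section Slices

variable {F : ℝ → ℝ → ℝ}

theorem hasDerivAt_fst_of_contDiff (hF : ContDiff ℝ 1 (fun p : ℝ × ℝ => F p.1 p.2)) (t x : ℝ) :
    HasDerivAt (fun τ => F τ x) (fderiv ℝ (fun p : ℝ × ℝ => F p.1 p.2) (t, x) (1, 0)) t := by
  have h := (hF.differentiable one_ne_zero (t, x)).hasFDerivAt
  exact h.comp_hasDerivAt t ((hasDerivAt_id t).prodMk (hasDerivAt_const t x))

theorem hasDerivAt_snd_of_contDiff (hF : ContDiff ℝ 1 (fun p : ℝ × ℝ => F p.1 p.2)) (t x : ℝ) :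
    HasDerivAt (fun y => F t y) (fderiv ℝ (fun p : ℝ × ℝ => F p.1 p.2) (t, x) (0, 1)) x := by
  have h := (hF.differentiable one_ne_zero (t, x)).hasFDerivAt
  exact h.comp_hasDerivAt x ((hasDerivAt_const x t).prodMk (hasDerivAt_id x))

theorem continuous_deriv_fst_of_contDiff (hF : ContDiff ℝ 1 (fun p : ℝ × ℝ => F p.1 p.2)) :
    Continuous (fun p : ℝ × ℝ => deriv (fun τ => F τ p.2) p.1) := by
  simp only [fun t x => (hasDerivAt_fst_of_contDiff hF t x).deriv]
  exact (hF.continuous_fderiv one_ne_zero).clm_apply continuous_const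

theorem continuous_deriv_snd_of_contDiff (hF : ContDiff ℝ 1 (fun p : ℝ × ℝ => F p.1 p.2)) :
    Continuous (fun p : ℝ × ℝ => deriv (fun y => F p.1 y) p.2) := by
  simp only [fun t x => (hasDerivAt_snd_of_contDiff hF t x).deriv]
  exact (hF.continuous_fderiv one_ne_zero).clm_apply continuous_const

/-- Differentiation under the integral sign for a `C¹` integrand on a compact interval. -/
theorem hasDerivAt_integral_of_contDiff_uncurried
    (hF : ContDiff ℝ 1 (fun p : ℝ × ℝ => F p.1 p.2)) (a b t : ℝ) :
    HasDerivAt (fun τ => ∫ x in a..b, F τ x) (∫ x in a..b, deriv (fun τ => F τ x) t) t := by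
  have hc := continuous_deriv_fst_of_contDiff hF
  have hslice : ∀ τ, Continuous (fun x => F τ x) := fun τ =>
    hF.continuous.comp (Continuous.prodMk_right τ)
  obtain ⟨M, hM⟩ := ((isCompact_closedBall t (1 : ℝ)).prod
    (isCompact_uIcc (a := a) (b := b))).exists_bound_of_continuousOn hc.continuousOn
  refine (intervalIntegral.hasDerivAt_integral_of_dominated_loc_of_deriv_le
    (F' := fun τ x => deriv (fun σ => F σ x) τ) (bound := fun _ => M)
    (Metric.ball_mem_nhds t one_pos)
    (Filter.Eventually.of_forall fun τ => (hslice τ).aestronglyMeasurable)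
    ((hslice t).intervalIntegrable a b)
    (hc.comp (Continuous.prodMk_right t)).aestronglyMeasurable
    (Filter.Eventually.of_forall fun x hx τ hτ =>
      hM (τ, x) ⟨Metric.ball_subset_closedBall hτ, Set.uIoc_subset_uIcc hx⟩)
    intervalIntegrable_const
    (Filter.Eventually.of_forall fun x _ τ _ =>
      (hasDerivAt_fst_of_contDiff hF τ x).differentiableAt.hasDerivAt)).2

theorem integral_deriv_snd_of_contDiff
    (hF : ContDiff ℝ 1 (fun p : ℝ × ℝ => F p.1 p.2)) (t a b : ℝ) :
    ∫ x in a..b, deriv (fun y => F t y) x = F t b - F t a :=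
  intervalIntegral.integral_deriv_eq_sub
    (fun x _ => (hasDerivAt_snd_of_contDiff hF t x).differentiableAt)
    (((continuous_deriv_snd_of_contDiff hF).comp
      (Continuous.prodMk_right t)).intervalIntegrable a b)

theorem integral_deriv_snd_eq_zero_of_periodic
    (hF : ContDiff ℝ 1 (fun p : ℝ × ℝ => F p.1 p.2)) {L t : ℝ}
    (hper : ∀ x, F t (x + L) = F t x) :
    ∫ x in (0 : ℝ)..L, deriv (fun y => F t y) x = 0 := by
  rw [integral_deriv_snd_of_contDiff hF, sub_eq_zero]
  simpa using hper 0

end Slices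

/-- Ampère's law up to a spatially constant term: it follows from Poisson's equation and the
continuity equation `∂ₜ ρ + c ∂ₓ J = 0`. -/
theorem deriv_field_sub_eq_of_continuity {E ρ J : ℝ → ℝ → ℝ} {ρ₀ c t : ℝ}
    (hE : ContDiff ℝ 1 (fun p : ℝ × ℝ => E p.1 p.2))
    (hρ : ContDiff ℝ 1 (fun p : ℝ × ℝ => ρ p.1 p.2))
    (hJ : ContDiff ℝ 1 (fun p : ℝ × ℝ => J p.1 p.2))
    (hPoisson : ∀ t x : ℝ, deriv (fun y => E t y) x = ρ t x - ρ₀)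
    (hcont : ∀ x, deriv (fun τ => ρ τ x) t = -(c * deriv (fun y => J t y) x)) (x : ℝ) :
    deriv (fun τ => E τ x) t - deriv (fun τ => E τ 0) t = -(c * (J t x - J t 0)) := by
  have hint : ∀ τ, ∫ y in (0 : ℝ)..x, (ρ τ y - ρ₀) = E τ x - E τ 0 := fun τ => by
    simp only [← hPoisson, integral_deriv_snd_of_contDiff hE]
  have h₁ := hasDerivAt_integral_of_contDiff_uncurried (F := fun τ y => ρ τ y - ρ₀)
    (hρ.sub contDiff_const) 0 x t
  simp only [hint, deriv_sub_const, hcont, intervalIntegral.integral_neg,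
    intervalIntegral.integral_const_mul, integral_deriv_snd_of_contDiff hJ] at h₁
  exact ((hasDerivAt_fst_of_contDiff hE t x).differentiableAt.hasDerivAt.sub
    (hasDerivAt_fst_of_contDiff hE t 0).differentiableAt.hasDerivAt).unique h₁

open MeasureTheory Real

/-- Conservation of total energy for the Hermite-spectral Vlasov–Poisson system. -/
theorem hermite_energy_conservation
    (N_H : ℕ) (hNH : 3 ≤ N_H)
    (L α₀ γ ρ₀ : ℝ) (hL : 0 < L) (hα₀ : 0 < α₀) (hγ : 0 < γ)
    (C : ℤ → ℝ → ℝ → ℝ) (Φ E : ℝ → ℝ → ℝ) (α αd Esup : ℝ → ℝ)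
    -- the Cₙ are C¹ and L-periodic in x, with Cₙ ≡ 0 for n < 0 and n ≥ N_H
    (hC1 : ∀ n : ℤ, ContDiff ℝ 1 (fun p : ℝ × ℝ => C n p.1 p.2))
    (hCper : ∀ (n : ℤ) (t x : ℝ), C n t (x + L) = C n t x)
    (hCneg : ∀ n : ℤ, n < 0 → C n = 0)
    (hCbig : ∀ n : ℤ, (N_H : ℤ) ≤ n → C n = 0)
    -- Φ, E are C¹ and L-periodic in x, with E = -∂ₓΦ and ∂ₓE = C₀ - ρ₀
    (hΦ1 : ContDiff ℝ 1 (fun p : ℝ × ℝ => Φ p.1 p.2))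
    (hE1 : ContDiff ℝ 1 (fun p : ℝ × ℝ => E p.1 p.2))
    (hΦper : ∀ t x : ℝ, Φ t (x + L) = Φ t x)
    (hEper : ∀ t x : ℝ, E t (x + L) = E t x)
    (hEΦ : ∀ t x : ℝ, E t x = - deriv (fun y => Φ t y) x)
    (hPoisson : ∀ t x : ℝ, deriv (fun y => E t y) x = C 0 t x - ρ₀)
    -- the sup norm in x of E, assumed continuous in t
    (hEsup : ∀ t, Esup t = ⨆ x : ℝ, |E t x|)
    (hEbdd : ∀ t, BddAbove (Set.range fun x : ℝ => |E t x|))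
    (hEsupCont : Continuous Esup)
    -- the scaling function α and its derivative α' = -(γ/2) ‖E‖_∞² α³
    (hα : ∀ t, α t = α₀ / Real.sqrt (1 + γ * ∫ s in (0:ℝ)..t, (Esup s) ^ 2))
    (hαd : ∀ t, αd t = -(γ / 2) * (Esup t) ^ 2 * (α t) ^ 3)
    (hαderiv : ∀ t, 0 ≤ t → HasDerivAt α (αd t) t)
    -- the Hermite-spectral Vlasov system
    (hVlasov : ∀ n : ℤ, 0 ≤ n → n < (N_H : ℤ) → ∀ t x : ℝ, 0 ≤ t →
      deriv (fun τ => C n τ x) t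
        - (αd t / α t) * ((n : ℝ) * C n t x + Real.sqrt (((n : ℝ) - 1) * (n : ℝ)) * C (n - 2) t x)
        + (1 / α t) * (Real.sqrt (n : ℝ) * deriv (fun y => C (n - 1) t y) x
            + Real.sqrt ((n : ℝ) + 1) * deriv (fun y => C (n + 1) t y) x)
        - α t * Real.sqrt (n : ℝ) * E t x * C (n - 1) t x = 0) :
    ∀ t, 0 ≤ t →
      (1 / 2) * ∫ x in (0:ℝ)..L,
          ((1 / (α t) ^ 2) * (Real.sqrt 2 * C 2 t x + C 0 t x) + (E t x) ^ 2)
        = (1 / 2) * ∫ x in (0:ℝ)..L,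
          ((1 / (α 0) ^ 2) * (Real.sqrt 2 * C 2 0 x + C 0 0 x) + (E 0 x) ^ 2) := by
  have hαpos : ∀ t, 0 ≤ t → 0 < α t := by
    intro t ht
    rw [hα]
    have : 0 ≤ ∫ s in (0 : ℝ)..t, (Esup s) ^ 2 :=
      intervalIntegral.integral_nonneg ht fun s _ => sq_nonneg _
    positivity
  have hslice : ∀ {F : ℝ → ℝ → ℝ}, ContDiff ℝ 1 (fun p : ℝ × ℝ => F p.1 p.2) →
      ∀ t, Continuous (fun x => F t x) := fun hF t =>
    hF.continuous.comp (Continuous.prodMk_right t)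
  have hsplit : ∀ t, ∫ x in (0 : ℝ)..L,
      ((1 / (α t) ^ 2) * (√2 * C 2 t x + C 0 t x) + (E t x) ^ 2)
      = (1 / (α t) ^ 2) * (∫ x in (0 : ℝ)..L, (√2 * C 2 t x + C 0 t x))
        + ∫ x in (0 : ℝ)..L, (E t x) ^ 2 := by
    intro t
    have h₂ := hslice (hC1 2) t
    have h₀ := hslice (hC1 0) t
    have hE := hslice hE1 t
    rw [intervalIntegral.integral_add, intervalIntegral.integral_const_mul]
    · exact Continuous.intervalIntegrable (by fun_prop) _ _
    · exact Continuous.intervalIntegrable (by fun_prop) _ _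
  have hdens : ∀ t x, 0 ≤ t →
      deriv (fun τ => C 0 τ x) t = -((1 / α t) * deriv (fun y => C 1 t y) x) := by
    intro t x ht
    have h := hVlasov 0 le_rfl (by omega) t x ht
    norm_num at h
    norm_num
    linarith
  have hsecond : ∀ t x, 0 ≤ t →
      deriv (fun τ => C 2 τ x) t = (αd t / α t) * (2 * C 2 t x + √2 * C 0 t x)
        - (1 / α t) * (√2 * deriv (fun y => C 1 t y) x + √3 * deriv (fun y => C 3 t y) x)
        + α t * √2 * E t x * C 1 t x := by
    intro t x ht
    have h := hVlasov 2 (by norm_num) (by omega) t x ht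
    norm_num at h
    norm_num
    linarith
  have hkin : ∀ t, 0 ≤ t → HasDerivAt (fun τ => ∫ x in (0 : ℝ)..L, (√2 * C 2 τ x + C 0 τ x))
      (2 * (αd t / α t) * (∫ x in (0 : ℝ)..L, (√2 * C 2 t x + C 0 t x))
        + 2 * α t * ∫ x in (0 : ℝ)..L, E t x * C 1 t x) t := by
    intro t ht
    have h := hasDerivAt_integral_of_contDiff_uncurried
      (F := fun τ x => √2 * C 2 τ x + C 0 τ x)
      ((contDiff_const.mul (hC1 2)).add (hC1 0)) 0 L t
    convert h using 1
    have hd : ∀ x, deriv (fun τ => √2 * C 2 τ x + C 0 τ x) t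
        = 2 * (αd t / α t) * (√2 * C 2 t x + C 0 t x) + 2 * α t * (E t x * C 1 t x)
          - (3 / α t) * deriv (fun y => C 1 t y) x
          - (√2 * √3 / α t) * deriv (fun y => C 3 t y) x := by
      intro x
      have e := ((hasDerivAt_fst_of_contDiff (hC1 2) t x).differentiableAt.hasDerivAt.const_mul
        √2).add (hasDerivAt_fst_of_contDiff (hC1 0) t x).differentiableAt.hasDerivAt
      refine e.deriv.trans ?_
      rw [hsecond t x ht, hdens t x ht]
      have h2 : √2 ^ 2 = (2 : ℝ) := Real.sq_sqrt (by norm_num)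
      linear_combination (αd t / α t * C 0 t x - (1 / α t) * deriv (fun y => C 1 t y) x
        + α t * E t x * C 1 t x) * h2
    have c₀ := hslice (hC1 0) t
    have c₁ := hslice (hC1 1) t
    have c₂ := hslice (hC1 2) t
    have cE := hslice hE1 t
    have d₁ : Continuous fun x => deriv (fun y => C 1 t y) x :=
      (continuous_deriv_snd_of_contDiff (hC1 1)).comp (Continuous.prodMk_right t)
    have d₃ : Continuous fun x => deriv (fun y => C 3 t y) x :=
      (continuous_deriv_snd_of_contDiff (hC1 3)).comp (Continuous.prodMk_right t)
    simp only [hd]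
    symm
    rw [intervalIntegral.integral_sub, intervalIntegral.integral_sub,
      intervalIntegral.integral_add, intervalIntegral.integral_const_mul,
      intervalIntegral.integral_const_mul, intervalIntegral.integral_const_mul,
      intervalIntegral.integral_const_mul,
      integral_deriv_snd_eq_zero_of_periodic (hC1 1) (hCper 1 t),
      integral_deriv_snd_eq_zero_of_periodic (hC1 3) (hCper 3 t)]
    · ring
    all_goals exact Continuous.intervalIntegrable (by fun_prop) _ _
  have hpot : ∀ t, 0 ≤ t → HasDerivAt (fun τ => ∫ x in (0 : ℝ)..L, (E τ x) ^ 2)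
      (-(2 / α t) * ∫ x in (0 : ℝ)..L, E t x * C 1 t x) t := by
    intro t ht
    have h := hasDerivAt_integral_of_contDiff_uncurried (F := fun τ x => (E τ x) ^ 2)
      (hE1.pow 2) 0 L t
    convert h using 1
    have hd : ∀ x, deriv (fun τ => (E τ x) ^ 2) t = -(2 / α t) * (E t x * C 1 t x)
        + (2 * (deriv (fun τ => E τ 0) t + (1 / α t) * C 1 t 0)) * E t x := by
      intro x
      have e := (hasDerivAt_fst_of_contDiff hE1 t x).differentiableAt.hasDerivAt.pow 2
      refine e.deriv.trans ?_
      have := deriv_field_sub_eq_of_continuity hE1 (hC1 0) (hC1 1) hPoisson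
        (fun x => hdens t x ht) x
      linear_combination 2 * E t x * this
    have hmean : ∫ x in (0 : ℝ)..L, E t x = 0 := by
      simp only [hEΦ, intervalIntegral.integral_neg,
        integral_deriv_snd_eq_zero_of_periodic hΦ1 (hΦper t), neg_zero]
    have c₁ := hslice (hC1 1) t
    have cE := hslice hE1 t
    simp only [hd]
    rw [intervalIntegral.integral_add, intervalIntegral.integral_const_mul,
      intervalIntegral.integral_const_mul, hmean, mul_zero, add_zero]
    all_goals exact Continuous.intervalIntegrable (by fun_prop) _ _
  have hderiv : ∀ t, 0 ≤ t → HasDerivAt (fun τ => ∫ x in (0 : ℝ)..L,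
      ((1 / (α τ) ^ 2) * (√2 * C 2 τ x + C 0 τ x) + (E τ x) ^ 2)) 0 t := by
    intro t ht
    have hne : α t ≠ 0 := (hαpos t ht).ne'
    rw [funext hsplit]
    simp only [one_div]
    have h := ((((hαderiv t ht).fun_pow 2).fun_inv (pow_ne_zero 2 hne)).fun_mul
      (hkin t ht)).fun_add (hpot t ht)
    refine h.congr_deriv ?_
    push_cast
    field_simp
    ring
  intro t ht
  rw [constant_of_has_deriv_right_zero
    (fun s hs => (hderiv s hs.1).continuousAt.continuousWithinAt)
    (fun s hs => (hderiv s hs.1).hasDerivWithinAt) t ⟨ht, le_rfl⟩]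
end

section
/- For the Fourier–Hermite Galerkin semi-discretization of the Vlasov–Poisson system, the weighted L² norm is globally stable: for all t ≥ 0, Σ_{n=0}^{N_H−1} α(t) ∫₀ᴸ C_n(t,x)² dx ≤ e^{t/(2γ)} Σ_{n=0}^{N_H−1} α(0) ∫₀ᴸ C_n(0,x)² dx. -/
open MeasureTheory Real

/-- The space of real trigonometric polynomials of degree at most `Nx` on `[0,L]`. -/
def inV (L : ℝ) (Nx : ℕ) (u : ℝ → ℝ) : Prop :=
  ∃ a b : ℕ → ℝ, u = fun x => ∑ j ∈ Finset.range (Nx + 1),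
    (a j * Real.cos (2 * π * j * x / L) + b j * Real.sin (2 * π * j * x / L))

theorem hasDerivAt_bilinForm_self {V : Type*} [AddCommGroup V] [Module ℝ V]
    [FiniteDimensional ℝ V] (B : LinearMap.BilinForm ℝ V) (hB : B.Nondegenerate)
    (hsymm : ∀ u v, B u v = B v u) {f : ℝ → V} {G : V → ℝ} {t : ℝ}
    (h : ∀ v, HasDerivAt (fun τ => B (f τ) v) (G v) t) :
    HasDerivAt (fun τ => B (f τ) (f τ)) (2 * G (f t)) t := by
  let b := Module.finBasis ℝ V
  let d := B.dualBasis hB b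
  have expand (u v : V) : B u v = ∑ i, B u (b i) * B v (d i) := by
    conv_lhs => rw [← d.sum_repr u]
    simp only [map_sum, LinearMap.sum_apply, map_smul, LinearMap.smul_apply, smul_eq_mul]
    refine Finset.sum_congr rfl fun i _ => ?_
    rw [LinearMap.BilinForm.dualBasis_repr_apply, hsymm (d i)]
  have expand' (u v : V) : B u v = ∑ i, B v (b i) * B u (d i) := by
    rw [hsymm, expand]
  have h₁ : G (f t) = ∑ i, G (b i) * B (f t) (d i) := by
    refine (h (f t)).unique ?_
    simp_rw [expand _ (f t)]
    exact HasDerivAt.fun_sum fun i _ => (h (b i)).mul_const _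
  have h₂ : G (f t) = ∑ i, B (f t) (b i) * G (d i) := by
    refine (h (f t)).unique ?_
    simp_rw [expand' _ (f t)]
    exact HasDerivAt.fun_sum fun i _ => (h (d i)).const_mul _
  have h₃ : HasDerivAt (fun τ => ∑ i, B (f τ) (b i) * B (f τ) (d i))
      (∑ i, (G (b i) * B (f t) (d i) + B (f t) (b i) * G (d i))) t :=
    HasDerivAt.fun_sum fun i _ => (h (b i)).mul (h (d i))
  rw [Finset.sum_add_distrib, ← h₁, ← h₂, ← two_mul] at h₃
  simpa only [← expand] using h₃

theorem inV.contDiff {L : ℝ} {N : ℕ} {u : ℝ → ℝ} (hu : inV L N u) : ContDiff ℝ 1 u := by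
  obtain ⟨a, b, rfl⟩ := hu
  fun_prop

theorem inV.periodic {L : ℝ} (hL : 0 < L) {N : ℕ} {u : ℝ → ℝ} (hu : inV L N u) :
    Function.Periodic u L := by
  obtain ⟨a, b, rfl⟩ := hu
  intro x
  refine Finset.sum_congr rfl fun j _ => ?_
  have : 2 * π * j * (x + L) / L = 2 * π * j * x / L + j * (2 * π) := by
    field_simp
  rw [this, Real.cos_add_nat_mul_two_pi, Real.sin_add_nat_mul_two_pi]

/-- The trigonometric polynomials of degree at most `N`, as a subspace of `ℝ → ℝ`. -/
def trigPolynomials (L : ℝ) (N : ℕ) : Submodule ℝ (ℝ → ℝ) where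
  carrier := {u | inV L N u}
  zero_mem' := ⟨0, 0, by ext; simp⟩
  add_mem' := by
    rintro _ _ ⟨a, b, rfl⟩ ⟨a', b', rfl⟩
    refine ⟨a + a', b + b', funext fun x => ?_⟩
    simp only [Pi.add_apply, ← Finset.sum_add_distrib]
    exact Finset.sum_congr rfl fun j _ => by ring
  smul_mem' := by
    rintro c _ ⟨a, b, rfl⟩
    refine ⟨c • a, c • b, funext fun x => ?_⟩
    simp only [Pi.smul_apply, smul_eq_mul, Finset.mul_sum]
    exact Finset.sum_congr rfl fun j _ => by ring

instance finiteDimensional_trigPolynomials (L : ℝ) (N : ℕ) :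
    FiniteDimensional ℝ (trigPolynomials L N) := by
  classical
  let c : ℕ → ℝ → ℝ := fun j x => Real.cos (2 * π * j * x / L)
  let s : ℕ → ℝ → ℝ := fun j x => Real.sin (2 * π * j * x / L)
  let S := (Finset.range (N + 1)).image c ∪ (Finset.range (N + 1)).image s
  refine Submodule.finiteDimensional_of_le (S₂ := Submodule.span ℝ (S : Set (ℝ → ℝ))) ?_
  rintro _ ⟨a, b, rfl⟩
  have : (fun x => ∑ j ∈ Finset.range (N + 1),
      (a j * Real.cos (2 * π * j * x / L) + b j * Real.sin (2 * π * j * x / L))) =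
      ∑ j ∈ Finset.range (N + 1), (a j • c j + b j • s j) := by
    ext x; simp [c, s]
  rw [this]
  refine Submodule.sum_mem _ fun j hj => Submodule.add_mem _ ?_ ?_
  · exact Submodule.smul_mem _ _ (Submodule.subset_span
      (Finset.mem_coe.2 (Finset.mem_union_left _ (Finset.mem_image_of_mem _ hj))))
  · exact Submodule.smul_mem _ _ (Submodule.subset_span
      (Finset.mem_coe.2 (Finset.mem_union_right _ (Finset.mem_image_of_mem _ hj))))

/-- The `L²(0, L)` pairing of trigonometric polynomials. -/
noncomputable def trigPairing (L : ℝ) (N : ℕ) : LinearMap.BilinForm ℝ (trigPolynomials L N) :=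
  have hint (u v : trigPolynomials L N) :
      IntervalIntegrable (fun x => u.1 x * v.1 x) volume 0 L :=
    (u.2.contDiff.continuous.mul v.2.contDiff.continuous).intervalIntegrable _ _
  LinearMap.mk₂ ℝ (fun u v => ∫ x in (0 : ℝ)..L, u.1 x * v.1 x)
    (fun u u' v => by
      simpa [add_mul] using intervalIntegral.integral_add (hint u v) (hint u' v))
    (fun c u v => by simp [mul_assoc])
    (fun u v v' => by
      simpa [mul_add] using intervalIntegral.integral_add (hint u v) (hint u v'))
    (fun c u v => by simp [mul_left_comm])

theorem trigPairing_apply (L : ℝ) (N : ℕ) (u v : trigPolynomials L N) :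
    trigPairing L N u v = ∫ x in (0 : ℝ)..L, u.1 x * v.1 x := rfl

theorem trigPairing_nondegenerate {L : ℝ} (hL : 0 < L) (N : ℕ) :
    (trigPairing L N).Nondegenerate := by
  have definite (u : trigPolynomials L N) (hu : trigPairing L N u u = 0) : u = 0 := by
    by_contra hne
    obtain ⟨y, hy⟩ : ∃ y, u.1 y ≠ 0 := by
      by_contra! h
      exact hne (Subtype.ext (funext h))
    obtain ⟨z, hz, hzy⟩ := (inV.periodic hL u.2).exists_mem_Ico₀ hL y
    have hcont : Continuous u.1 := u.2.contDiff.continuous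
    have hpos : 0 < ∫ x in (0 : ℝ)..L, u.1 x * u.1 x :=
      intervalIntegral.integral_pos hL (hcont.mul hcont).continuousOn
        (fun x _ => mul_self_nonneg _)
        ⟨z, Set.Ico_subset_Icc_self hz, mul_self_pos.2 (hzy ▸ hy)⟩
    exact hpos.ne' hu
  exact ⟨fun u hu => definite u (hu u), fun u hu => definite u (hu u)⟩

/-- A curve of trigonometric polynomials which is weakly differentiable has a differentiable
square norm. -/
theorem hasDerivAt_integral_sq {L : ℝ} (hL : 0 < L) {N : ℕ} {u : ℝ → ℝ → ℝ}
    (hu : ∀ τ, inV L N (u τ)) {G : (ℝ → ℝ) → ℝ} {t : ℝ}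
    (h : ∀ φ, inV L N φ → HasDerivAt (fun τ => ∫ x in (0 : ℝ)..L, u τ x * φ x) (G φ) t) :
    HasDerivAt (fun τ => ∫ x in (0 : ℝ)..L, u τ x ^ 2) (2 * G (u t)) t := by
  simp_rw [pow_two]
  exact hasDerivAt_bilinForm_self (trigPairing L N) (trigPairing_nondegenerate hL N)
    (fun v w => by simp only [trigPairing_apply, mul_comm])
    (f := fun τ => ⟨u τ, hu τ⟩) (G := fun v => G v.1) fun v => h v.1 v.2

theorem integral_mul_deriv_of_inV {L : ℝ} (hL : 0 < L) {N : ℕ} {u v : ℝ → ℝ}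
    (hu : inV L N u) (hv : inV L N v) :
    ∫ x in (0 : ℝ)..L, u x * deriv v x = -∫ x in (0 : ℝ)..L, v x * deriv u x := by
  have key := intervalIntegral.integral_mul_deriv_eq_deriv_mul (a := 0) (b := L)
    (fun x _ => (hu.contDiff.differentiable one_ne_zero x).hasDerivAt)
    (fun x _ => (hv.contDiff.differentiable one_ne_zero x).hasDerivAt)
    ((hu.contDiff.continuous_deriv le_rfl).intervalIntegrable _ _)
    ((hv.contDiff.continuous_deriv le_rfl).intervalIntegrable _ _)
  have hu0 := (hu.periodic hL).eq
  have hv0 := (hv.periodic hL).eq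
  rw [key, hu0, hv0]
  simp only [sub_self, zero_sub, mul_comm]

/-- The streaming terms telescope in the energy balance. -/
theorem sum_streaming_eq_zero {L : ℝ} (hL : 0 < L) {N M : ℕ} {c : ℤ → ℝ → ℝ}
    (hc : ∀ n, inV L N (c n)) (hM : c M = 0) :
    ∑ n ∈ Finset.range M, ∫ x in (0 : ℝ)..L,
      (√((n : ℤ) : ℝ) * c ((n : ℤ) - 1) x + √(((n : ℤ) : ℝ) + 1) * c ((n : ℤ) + 1) x)
        * deriv (c n) x = 0 := by
  let D : ℕ → ℝ := fun n => √(n : ℝ) * ∫ x in (0 : ℝ)..L, c ((n : ℤ) - 1) x * deriv (c n) x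
  have hterm (n : ℕ) : ∫ x in (0 : ℝ)..L,
      (√((n : ℤ) : ℝ) * c ((n : ℤ) - 1) x + √(((n : ℤ) : ℝ) + 1) * c ((n : ℤ) + 1) x)
        * deriv (c n) x = D n - D (n + 1) := by
    have hint (m : ℤ) : IntervalIntegrable (fun x => c m x * deriv (c n) x) volume 0 L :=
      ((hc m).contDiff.continuous.mul
        ((hc n).contDiff.continuous_deriv le_rfl)).intervalIntegrable _ _
    simp only [add_mul, mul_assoc]
    rw [intervalIntegral.integral_add ((hint _).const_mul _) ((hint _).const_mul _),
      intervalIntegral.integral_const_mul, intervalIntegral.integral_const_mul,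
      integral_mul_deriv_of_inV hL (hc (n + 1)) (hc n)]
    simp [D, sub_eq_add_neg]
  rw [Finset.sum_congr rfl fun n _ => hterm n, Finset.sum_range_sub']
  simp [D, hM]

/-- The contribution of the mode `n` to the energy balance, apart from streaming. -/
noncomputable def modeBalance (a a' k e : ℝ) (c : ℤ → ℝ) (n : ℤ) : ℝ :=
  a' * c n ^ 2 + 2 * a' * ((n * c n + √((n - 1) * n) * c (n - 2)) * c n)
    + 2 * a ^ 2 * √n * (e * c (n - 1) * c n) - a * k * c n ^ 2

theorem sum_modeBalance_le {a a' k e : ℝ} {c : ℤ → ℝ} (hneg : ∀ n < 0, c n = 0)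
    (hquad : ∀ w v : ℝ, a' * w ^ 2 + a ^ 2 * e * w * v - a * k * v ^ 2 ≤ 0) (M : ℕ) :
    ∑ n ∈ Finset.range M, modeBalance a a' k e c n ≤
      a' * (M * c (M - 1) ^ 2 + (M - 1) * c (M - 2) ^ 2)
        + a ^ 2 * e * √((M : ℝ) - 1) * c (M - 1) * c (M - 2) - a * k * c (M - 1) ^ 2 := by
  induction M with
  | zero => simp [hneg]
  | succ M ih =>
    rw [Finset.sum_range_succ]
    have hw := hquad (√M * c M + √((M : ℝ) - 1) * c (M - 2)) (c (M - 1))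
    have hs : √(M : ℝ) ^ 2 = M := Real.sq_sqrt (Nat.cast_nonneg M)
    have hs' : √((M : ℝ) - 1) ^ 2 * c (M - 2) ^ 2 = (M - 1) * c (M - 2) ^ 2 := by
      rcases Nat.eq_zero_or_pos M with rfl | hM
      · simp [hneg]
      · rw [Real.sq_sqrt (sub_nonneg.2 (by exact_mod_cast hM))]
    have hprod : √(((M : ℝ) - 1) * M) = √((M : ℝ) - 1) * √M :=
      Real.sqrt_mul' _ (Nat.cast_nonneg M)
    have i₁ : ((M + 1 : ℕ) : ℤ) - 1 = M := by push_cast; ring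
    have i₂ : ((M + 1 : ℕ) : ℤ) - 2 = M - 1 := by push_cast; ring
    have hmode : modeBalance a a' k e c M =
        a' * c M ^ 2 + 2 * a' * ((M * c M + √((M : ℝ) - 1) * √M * c (M - 2)) * c M)
          + 2 * a ^ 2 * √M * (e * c (M - 1) * c M) - a * k * c M ^ 2 := by
      simp only [modeBalance, Int.cast_natCast, hprod]
    rw [i₁, i₂, hmode, Nat.cast_succ, add_sub_cancel_right]
    linear_combination ih + hw - a' * c M ^ 2 * hs - a' * hs'

theorem sum_modeBalance_nonpos {a a' k e : ℝ} {c : ℤ → ℝ} (hneg : ∀ n < 0, c n = 0) {M : ℕ}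
    (hbig : ∀ n : ℤ, M ≤ n → c n = 0)
    (hquad : ∀ w v : ℝ, a' * w ^ 2 + a ^ 2 * e * w * v - a * k * v ^ 2 ≤ 0) :
    ∑ n ∈ Finset.range M, modeBalance a a' k e c n ≤ 0 := by
  have h := sum_modeBalance_le hneg hquad (M + 2)
  have z (n : ℤ) (hn : (M : ℤ) ≤ n) : modeBalance a a' k e c n = 0 := by
    simp [modeBalance, hbig n hn]
  rw [Finset.sum_range_succ, Finset.sum_range_succ, z _ le_rfl, z _ (by push_cast; omega),
    hbig _ (by push_cast; omega), hbig (((M + 2 : ℕ) : ℤ) - 2) (by push_cast; omega)] at h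
  simpa using h

theorem le_exp_mul_of_deriv_le {S S' : ℝ → ℝ} {k : ℝ}
    (hS : ∀ t, 0 ≤ t → HasDerivAt S (S' t) t) (hle : ∀ t, 0 ≤ t → S' t ≤ k * S t)
    {t : ℝ} (ht : 0 ≤ t) : S t ≤ Real.exp (k * t) * S 0 := by
  have hd (s : ℝ) (hs : 0 ≤ s) : HasDerivAt (fun r => Real.exp (-(k * r)) * S r)
      (Real.exp (-(k * s)) * (-(k * 1)) * S s + Real.exp (-(k * s)) * S' s) s :=
    (((hasDerivAt_id s).const_mul k).neg.exp).mul (hS s hs)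
  have hanti : AntitoneOn (fun r => Real.exp (-(k * r)) * S r) (Set.Ici 0) := by
    refine antitoneOn_of_deriv_nonpos (convex_Ici 0)
      (fun s hs => (hd s hs).continuousAt.continuousWithinAt) ?_ ?_ <;>
      rw [interior_Ici] <;> intro s hs
    · exact (hd s (le_of_lt hs)).differentiableAt.differentiableWithinAt
    · rw [(hd s (le_of_lt hs)).deriv]
      nlinarith [Real.exp_pos (-(k * s)), hle s (le_of_lt hs)]
  have h := hanti Set.self_mem_Ici ht ht
  simp only [mul_zero, neg_zero, Real.exp_zero, one_mul] at h
  calc S t = Real.exp (k * t) * (Real.exp (-(k * t)) * S t) := by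
        rw [← mul_assoc, ← Real.exp_add]; simp
    _ ≤ _ := mul_le_mul_of_nonneg_left h (Real.exp_pos _).le

theorem scaling_quadratic_nonpos {a γ m e : ℝ} (ha : 0 < a) (hγ : 0 < γ) (hem : |e| ≤ m)
    (w v : ℝ) :
    -(γ / 2) * m ^ 2 * a ^ 3 * w ^ 2 + a ^ 2 * e * w * v - a * (1 / (2 * γ)) * v ^ 2 ≤ 0 := by
  have hsq : e ^ 2 ≤ m ^ 2 := sq_le_sq' (abs_le.1 hem).1 (abs_le.1 hem).2
  have h₁ : 0 ≤ a / (2 * γ) * (γ * a * e * w - v) ^ 2 := by positivity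
  have h₂ : 0 ≤ γ / 2 * a ^ 3 * w ^ 2 * (m ^ 2 - e ^ 2) :=
    mul_nonneg (by positivity) (sub_nonneg.2 hsq)
  have h₃ : a / (2 * γ) * (γ * a * e * w - v) ^ 2 =
      γ / 2 * a ^ 3 * w ^ 2 * e ^ 2 - a ^ 2 * e * w * v + a * (1 / (2 * γ)) * v ^ 2 := by
    field_simp
    ring
  linarith

/-- Global weighted L² stability for the Fourier–Hermite Galerkin
semi-discretization of the Vlasov–Poisson system. -/
theorem fourier_hermite_weighted_L2_stability
    (N_H N_x : ℕ) (hNH : 3 ≤ N_H) (hNx : 1 ≤ N_x)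
    (L α₀ γ ρ₀ : ℝ) (hL : 0 < L) (hα₀ : 0 < α₀) (hγ : 0 < γ)
    (C : ℤ → ℝ → ℝ → ℝ) (Φ E : ℝ → ℝ → ℝ) (α αd Esup : ℝ → ℝ)
    -- Cₙ(t,·) ∈ V_{N_x}, differentiable in t, with Cₙ ≡ 0 for n < 0 and n ≥ N_H
    (hCV : ∀ (n : ℤ) (t : ℝ), inV L N_x (C n t))
    (hCdiff : ∀ (n : ℤ) (x : ℝ), Differentiable ℝ (fun t => C n t x))
    (hCneg : ∀ n : ℤ, n < 0 → C n = 0)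
    (hCbig : ∀ n : ℤ, (N_H : ℤ) ≤ n → C n = 0)
    -- Φ(t,·), E(t,·), ∂ₜE(t,·) ∈ V_{N_x}, depending continuously on t
    (hΦV : ∀ t : ℝ, inV L N_x (Φ t))
    (hEV : ∀ t : ℝ, inV L N_x (E t))
    (hEdiff : ∀ x : ℝ, Differentiable ℝ (fun t => E t x))
    (hEtV : ∀ t : ℝ, inV L N_x (fun x => deriv (fun τ => E τ x) t))
    (hΦcont : ∀ x : ℝ, Continuous (fun t => Φ t x))
    (hEcont : ∀ x : ℝ, Continuous (fun t => E t x))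
    -- the sup norm in x of E, assumed continuous in t
    (hEsup : ∀ t, Esup t = ⨆ x : ℝ, |E t x|)
    (hEbdd : ∀ t, BddAbove (Set.range fun x : ℝ => |E t x|))
    (hEsupCont : Continuous Esup)
    -- the scaling function α and its derivative α' = -(γ/2) ‖E‖_∞² α³
    (hα : ∀ t, α t = α₀ / Real.sqrt (1 + γ * ∫ s in (0:ℝ)..t, (Esup s) ^ 2))
    (hαd : ∀ t, αd t = -(γ / 2) * (Esup t) ^ 2 * (α t) ^ 3)
    (hαderiv : ∀ t, 0 ≤ t → HasDerivAt α (αd t) t)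
    -- the Galerkin formulation of the Hermite-spectral Vlasov equation
    (hGalerkin : ∀ n : ℤ, 0 ≤ n → n < (N_H : ℤ) → ∀ t : ℝ, 0 ≤ t →
      ∀ φ : ℝ → ℝ, inV L N_x φ →
      HasDerivAt (fun τ => ∫ x in (0:ℝ)..L, C n τ x * φ x)
        ((αd t / α t) * (∫ x in (0:ℝ)..L,
            ((n : ℝ) * C n t x + Real.sqrt (((n : ℝ) - 1) * (n : ℝ)) * C (n - 2) t x) * φ x)
          + (1 / α t) * (∫ x in (0:ℝ)..L,
            (Real.sqrt (n : ℝ) * C (n - 1) t x + Real.sqrt ((n : ℝ) + 1) * C (n + 1) t x)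
              * deriv φ x)
          + α t * Real.sqrt (n : ℝ) * ∫ x in (0:ℝ)..L, E t x * C (n - 1) t x * φ x) t)
    -- the Galerkin formulation of the Poisson equation
    (hPoisson1 : ∀ t : ℝ, 0 ≤ t → ∀ η : ℝ → ℝ, inV L N_x η →
      ∫ x in (0:ℝ)..L, Φ t x * deriv η x = ∫ x in (0:ℝ)..L, E t x * η x)
    (hPoisson2 : ∀ t : ℝ, 0 ≤ t → ∀ ζ : ℝ → ℝ, inV L N_x ζ →
      -∫ x in (0:ℝ)..L, E t x * deriv ζ x = ∫ x in (0:ℝ)..L, (C 0 t x - ρ₀) * ζ x) :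
    ∀ t, 0 ≤ t →
      ∑ n ∈ Finset.range N_H, α t * ∫ x in (0:ℝ)..L, (C n t x) ^ 2
        ≤ Real.exp (t / (2 * γ)) *
          ∑ n ∈ Finset.range N_H, α 0 * ∫ x in (0:ℝ)..L, (C n 0 x) ^ 2 := by
  have hαpos (t : ℝ) (ht : 0 ≤ t) : 0 < α t := by
    have := intervalIntegral.integral_nonneg (μ := volume) ht (fun s _ => sq_nonneg (Esup s))
    rw [hα]
    positivity
  have hEle (t x : ℝ) : |E t x| ≤ Esup t := hEsup t ▸ le_ciSup (hEbdd t) x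
  let k : ℝ := 1 / (2 * γ)
  let T : ℕ → ℝ → ℝ := fun n t => ∫ x in (0 : ℝ)..L,
    (√((n : ℤ) : ℝ) * C ((n : ℤ) - 1) t x + √(((n : ℤ) : ℝ) + 1) * C ((n : ℤ) + 1) t x)
      * deriv (C n t) x
  let G : ℕ → ℝ → ℝ := fun n t =>
    (αd t / α t) * (∫ x in (0 : ℝ)..L,
      (((n : ℤ) : ℝ) * C n t x
        + √((((n : ℤ) : ℝ) - 1) * ((n : ℤ) : ℝ)) * C ((n : ℤ) - 2) t x) * C n t x)
    + (1 / α t) * T n t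
    + α t * √((n : ℤ) : ℝ) * ∫ x in (0 : ℝ)..L, E t x * C ((n : ℤ) - 1) t x * C n t x
  let q : ℕ → ℝ → ℝ → ℝ := fun n t x =>
    modeBalance (α t) (αd t) k (E t x) (fun m => C m t x) n
  have hsq (n : ℕ) (hn : n < N_H) (t : ℝ) (ht : 0 ≤ t) :
      HasDerivAt (fun τ => ∫ x in (0 : ℝ)..L, C n τ x ^ 2) (2 * G n t) t :=
    hasDerivAt_integral_sq hL (hCV n)
      (hGalerkin n (Int.natCast_nonneg n) (by exact_mod_cast hn) t ht)
  have hCc (m : ℤ) (t : ℝ) : Continuous (C m t) := (hCV m t).contDiff.continuous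
  have hEc (t : ℝ) : Continuous (E t) := (hEV t).contDiff.continuous
  have hqc (n : ℕ) (t : ℝ) : Continuous (q n t) := by
    have h₁ := hCc n t
    have h₂ := hCc (n - 1) t
    have h₃ := hCc (n - 2) t
    have h₄ := hEc t
    simp only [q, modeBalance]
    fun_prop
  have hbalance (n : ℕ) (t : ℝ) (ht : 0 ≤ t) :
      αd t * (∫ x in (0 : ℝ)..L, C n t x ^ 2) + α t * (2 * G n t)
        = 2 * T n t + (∫ x in (0 : ℝ)..L, q n t x)
          + k * (α t * ∫ x in (0 : ℝ)..L, C n t x ^ 2) := by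
    have c₁ := hCc n t
    have c₂ := hCc (n - 1) t
    have c₃ := hCc (n - 2) t
    have c₄ := hEc t
    have hq : ∫ x in (0 : ℝ)..L, q n t x =
        αd t * (∫ x in (0 : ℝ)..L, C n t x ^ 2)
        + 2 * αd t * (∫ x in (0 : ℝ)..L, (((n : ℤ) : ℝ) * C n t x
            + √((((n : ℤ) : ℝ) - 1) * ((n : ℤ) : ℝ)) * C ((n : ℤ) - 2) t x) * C n t x)
        + 2 * α t ^ 2 * √((n : ℤ) : ℝ) *
          (∫ x in (0 : ℝ)..L, E t x * C ((n : ℤ) - 1) t x * C n t x)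
        - α t * k * (∫ x in (0 : ℝ)..L, C n t x ^ 2) := by
      simp only [← intervalIntegral.integral_const_mul]
      rw [← intervalIntegral.integral_add, ← intervalIntegral.integral_add,
        ← intervalIntegral.integral_sub]
      · rfl
      all_goals
        refine Continuous.intervalIntegrable ?_ _ _
        fun_prop
    have hα0 := (hαpos t ht).ne'
    rw [hq]
    simp only [G]
    field_simp
    ring
  have hstream (t : ℝ) : ∑ n ∈ Finset.range N_H, T n t = 0 :=
    sum_streaming_eq_zero hL (c := fun m => C m t) (fun m => hCV m t)
      (by simp [hCbig N_H le_rfl])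
  have hqsum (t : ℝ) (ht : 0 ≤ t) :
      ∑ n ∈ Finset.range N_H, ∫ x in (0 : ℝ)..L, q n t x ≤ 0 := by
    rw [← intervalIntegral.integral_finsetSum
      fun n _ => (hqc n t).intervalIntegrable _ _]
    have hnonneg : 0 ≤ ∫ x in (0 : ℝ)..L, -∑ n ∈ Finset.range N_H, q n t x := by
      refine intervalIntegral.integral_nonneg hL.le fun x _ => neg_nonneg.2 ?_
      refine sum_modeBalance_nonpos (fun m hm => by simp [hCneg m hm])
        (fun m hm => by simp [hCbig m hm]) fun w v => ?_
      rw [hαd]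
      exact scaling_quadratic_nonpos (hαpos t ht) hγ (hEle t x) w v
    rw [intervalIntegral.integral_neg] at hnonneg
    linarith
  intro t ht
  rw [show t / (2 * γ) = k * t by simp only [k]; ring]
  refine le_exp_mul_of_deriv_le
    (S := fun τ => ∑ n ∈ Finset.range N_H, α τ * ∫ x in (0 : ℝ)..L, C n τ x ^ 2)
    (fun s hs => HasDerivAt.fun_sum fun n hn =>
      (hαderiv s hs).mul (hsq n (Finset.mem_range.1 hn) s hs)) (fun s hs => ?_) ht
  rw [Finset.sum_congr rfl fun n _ => hbalance n s hs, Finset.sum_add_distrib,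
    Finset.sum_add_distrib, ← Finset.mul_sum, ← Finset.mul_sum, hstream]
  linarith [hqsum s hs]
end

section
/- For the semi-discrete discontinuous Galerkin / Hermite scheme coupled with the local discontinuous Galerkin discretization of the Poisson equation, the discrete momentum satisfies the identity: for all t ≥ 0, (d/dt) ∫₀ᴸ C_{1,h}(t,x)/α(t) dx = β Σ_{j=1}^{N_x} [Φ_h]_{j−1/2}(t) [E_h]_{j−1/2}(t). -/
open MeasureTheory Real

/-- Shifting the summation index cyclically on `{1, …, N}` does not change a sum. -/
theorem sum_Icc_cyclic_shift {M : Type*} [AddCommMonoid M] {N : ℕ} (hN : 1 ≤ N) (F : ℕ → M) :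
    ∑ j ∈ Finset.Icc 1 N, F (if j = N then 1 else j + 1) = ∑ j ∈ Finset.Icc 1 N, F j := by
  refine Finset.sum_bij' (fun j _ => if j = N then 1 else j + 1)
    (fun j _ => if j = 1 then N else j - 1) ?_ ?_ ?_ ?_ ?_
  all_goals grind

/-- The integral of a polynomial against its derivative. -/
theorem integral_eval_mul_eval_derivative (p : Polynomial ℝ) (a b : ℝ) :
    ∫ x in a..b, p.eval x * (Polynomial.derivative p).eval x
      = (p.eval b ^ 2 - p.eval a ^ 2) / 2 := by
  have h : ∀ x ∈ Set.uIcc a b, HasDerivAt (fun x => p.eval x ^ 2 / 2)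
      (p.eval x * (Polynomial.derivative p).eval x) x := fun x _ => by
    refine (((p.hasDerivAt x).fun_pow 2).div_const 2).congr_deriv ?_
    push_cast
    ring
  rw [intervalIntegral.integral_eq_sub_of_hasDerivAt h
    (Continuous.intervalIntegrable (by fun_prop) _ _)]
  ring

/-- The discrete momentum identity for the semi-discrete DG/Hermite scheme
coupled with the local discontinuous Galerkin Poisson solver:
`d/dt ∫₀ᴸ C_{1,h}/α dx = β Σⱼ [Φ_h]_{j-1/2} [E_h]_{j-1/2}`. -/
theorem dg_hermite_ldg_momentum_identity
    (N_H k N_x : ℕ) (hNH : 3 ≤ N_H) (hNx : 1 ≤ N_x)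
    (L α₀ γ ρ₀ β : ℝ) (hL : 0 < L) (hα₀ : 0 < α₀) (hγ : 0 < γ) (hβ : 0 < β)
    -- the mesh 0 = x_{1/2} < x_{3/2} < ⋯ < x_{N_x+1/2} = L; `X j` is the node x_{j+1/2}
    (X : ℕ → ℝ) (hX0 : X 0 = 0) (hXL : X N_x = L)
    (hXmono : ∀ j, j < N_x → X j < X (j + 1))
    -- the piecewise-polynomial coefficients: `C n t j` is the polynomial of degree ≤ k
    -- representing C_{n,h}(t,·) on the cell I_j = [X (j-1), X j], j = 1, …, N_x
    (C : ℤ → ℝ → ℕ → Polynomial ℝ)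
    (hdeg : ∀ (n : ℤ) (t : ℝ) (j : ℕ), (C n t j).natDegree ≤ k)
    (hCneg : ∀ n : ℤ, n < 0 → ∀ (t : ℝ) (j : ℕ), C n t j = 0)
    (hCbig : ∀ n : ℤ, (N_H : ℤ) ≤ n → ∀ (t : ℝ) (j : ℕ), C n t j = 0)
    (hCdiff : ∀ (n : ℤ) (j : ℕ) (x : ℝ), Differentiable ℝ (fun t => (C n t j).eval x))
    -- the piecewise-polynomial potential Φ_h and electric field E_h, in V_h^k,
    -- depending differentiably on t
    (Φh Eh : ℝ → ℕ → Polynomial ℝ)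
    (hΦdeg : ∀ (t : ℝ) (j : ℕ), (Φh t j).natDegree ≤ k)
    (hEdeg : ∀ (t : ℝ) (j : ℕ), (Eh t j).natDegree ≤ k)
    (hΦdiff : ∀ (j : ℕ) (x : ℝ), Differentiable ℝ (fun t => (Φh t j).eval x))
    (hEdiff : ∀ (j : ℕ) (x : ℝ), Differentiable ℝ (fun t => (Eh t j).eval x))
    -- the sup norm of E_h on [0,L], assumed continuous in t
    (Einf : ℝ → ℝ)
    (hEinf : ∀ t, Einf t =
      sSup {y | ∃ j ∈ Finset.Icc 1 N_x, ∃ x ∈ Set.Icc (X (j - 1)) (X j), y = |(Eh t j).eval x|})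
    (hEcont : Continuous Einf)
    -- the scaling function α and its derivative α' = -(γ/2) ‖E_h‖_∞² α³
    (α αd : ℝ → ℝ)
    (hα : ∀ t, α t = α₀ / Real.sqrt (1 + γ * ∫ s in (0:ℝ)..t, (Einf s) ^ 2))
    (hαd : ∀ t, αd t = -(γ / 2) * (Einf t) ^ 2 * (α t) ^ 3)
    (hαderiv : ∀ t, 0 ≤ t → HasDerivAt α (αd t) t)
    -- traces at the node x_{j-1/2} (left value `m`, right value `p`),
    -- with periodic identification of x_{1/2} and x_{N_x+1/2}
    (Cm Cp : ℤ → ℝ → ℕ → ℝ) (Φm Φp Em Ep : ℝ → ℕ → ℝ)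
    (hCm : ∀ (n : ℤ) (t : ℝ) (j : ℕ),
      Cm n t j = (C n t (if j = 1 then N_x else j - 1)).eval (if j = 1 then X N_x else X (j - 1)))
    (hCp : ∀ (n : ℤ) (t : ℝ) (j : ℕ), Cp n t j = (C n t j).eval (X (j - 1)))
    (hΦm : ∀ (t : ℝ) (j : ℕ),
      Φm t j = (Φh t (if j = 1 then N_x else j - 1)).eval (if j = 1 then X N_x else X (j - 1)))
    (hΦp : ∀ (t : ℝ) (j : ℕ), Φp t j = (Φh t j).eval (X (j - 1)))
    (hEm : ∀ (t : ℝ) (j : ℕ),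
      Em t j = (Eh t (if j = 1 then N_x else j - 1)).eval (if j = 1 then X N_x else X (j - 1)))
    (hEp : ∀ (t : ℝ) (j : ℕ), Ep t j = (Eh t j).eval (X (j - 1)))
    -- the numerical viscosity δₙ : δ₀ = 0 and δₙ = √(N_H)/α for 1 ≤ n ≤ N_H - 1
    (δ : ℤ → ℝ → ℝ)
    (hδ : ∀ (n : ℤ) (t : ℝ), δ n t = if n = 0 then 0 else Real.sqrt (N_H : ℝ) / α t)
    -- the numerical flux ĝₙ = (1/2)(gₙ⁻ + gₙ⁺ - δₙ (Cₙ⁺ - Cₙ⁻)) at the node x_{j-1/2}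
    (ghat : ℤ → ℝ → ℕ → ℝ)
    (hghat : ∀ (n : ℤ) (t : ℝ) (j : ℕ),
      ghat n t j = (1 / 2) *
        ((1 / α t) * (Real.sqrt ((n : ℝ) + 1) * Cm (n + 1) t j + Real.sqrt (n : ℝ) * Cm (n - 1) t j)
          + (1 / α t) * (Real.sqrt ((n : ℝ) + 1) * Cp (n + 1) t j + Real.sqrt (n : ℝ) * Cp (n - 1) t j)
          - δ n t * (Cp n t j - Cm n t j)))
    -- the LDG fluxes Φ̂ = {Φ_h} and Ê = {E_h} - β[Φ_h] at the node x_{j-1/2}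
    (Φhat Ehat : ℝ → ℕ → ℝ)
    (hΦhat : ∀ (t : ℝ) (j : ℕ), Φhat t j = (Φp t j + Φm t j) / 2)
    (hEhat : ∀ (t : ℝ) (j : ℕ),
      Ehat t j = (Ep t j + Em t j) / 2 - β * (Φp t j - Φm t j))
    -- the semi-discrete DG scheme: for every cell j and test polynomial φ of degree ≤ k
    (hDG : ∀ n : ℤ, 0 ≤ n → n < (N_H : ℤ) → ∀ j ∈ Finset.Icc 1 N_x, ∀ t : ℝ, 0 ≤ t →
      ∀ φ : Polynomial ℝ, φ.natDegree ≤ k →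
      HasDerivAt (fun τ => ∫ x in X (j - 1)..X j, (C n τ j).eval x * φ.eval x)
        ((αd t / α t) * (∫ x in X (j - 1)..X j,
            ((n : ℝ) * (C n t j).eval x
              + Real.sqrt (((n : ℝ) - 1) * (n : ℝ)) * (C (n - 2) t j).eval x) * φ.eval x)
          - (-(∫ x in X (j - 1)..X j,
                (1 / α t) * (Real.sqrt ((n : ℝ) + 1) * (C (n + 1) t j).eval x
                  + Real.sqrt (n : ℝ) * (C (n - 1) t j).eval x)
                  * (Polynomial.derivative φ).eval x)
              + ghat n t (if j = N_x then 1 else j + 1) * φ.eval (X j)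
              - ghat n t j * φ.eval (X (j - 1)))
          + α t * Real.sqrt (n : ℝ) *
            ∫ x in X (j - 1)..X j, (Eh t j).eval x * (C (n - 1) t j).eval x * φ.eval x) t)
    -- the LDG approximation of the Poisson equation
    (hLDG1 : ∀ t : ℝ, 0 ≤ t → ∀ j ∈ Finset.Icc 1 N_x, ∀ η : Polynomial ℝ, η.natDegree ≤ k →
      (∫ x in X (j - 1)..X j, (Φh t j).eval x * (Polynomial.derivative η).eval x)
          - Φhat t (if j = N_x then 1 else j + 1) * η.eval (X j)
          + Φhat t j * η.eval (X (j - 1))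
        = ∫ x in X (j - 1)..X j, (Eh t j).eval x * η.eval x)
    (hLDG2 : ∀ t : ℝ, 0 ≤ t → ∀ j ∈ Finset.Icc 1 N_x, ∀ ζ : Polynomial ℝ, ζ.natDegree ≤ k →
      -(∫ x in X (j - 1)..X j, (Eh t j).eval x * (Polynomial.derivative ζ).eval x)
          + Ehat t (if j = N_x then 1 else j + 1) * ζ.eval (X j)
          - Ehat t j * ζ.eval (X (j - 1))
        = ∫ x in X (j - 1)..X j, ((C 0 t j).eval x - ρ₀) * ζ.eval x) :
    ∀ t, 0 ≤ t →
      HasDerivAt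
        (fun τ => ∑ j ∈ Finset.Icc 1 N_x, ∫ x in X (j - 1)..X j, (C 1 τ j).eval x / α τ)
        (β * ∑ j ∈ Finset.Icc 1 N_x, (Φp t j - Φm t j) * (Ep t j - Em t j)) t := by
  intro t ht
  have hαpos : 0 < α t := by
    rw [hα]
    have hint : 0 ≤ ∫ s in (0:ℝ)..t, (Einf s) ^ 2 :=
      intervalIntegral.integral_nonneg ht fun s _ => sq_nonneg _
    positivity
  have hα0 := hαpos.ne'
  have hE0 : ∑ j ∈ Finset.Icc 1 N_x, ∫ x in X (j - 1)..X j, (Eh t j).eval x = 0 := by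
    have hcell : ∀ j ∈ Finset.Icc 1 N_x, ∫ x in X (j - 1)..X j, (Eh t j).eval x
        = Φhat t j - Φhat t (if j = N_x then 1 else j + 1) := fun j hj => by
      have h := hLDG1 t ht j hj 1 (by simp)
      simp only [Polynomial.derivative_one, Polynomial.eval_zero, Polynomial.eval_one, mul_zero,
        mul_one, intervalIntegral.integral_zero] at h
      linarith
    rw [Finset.sum_congr rfl hcell, Finset.sum_sub_distrib, sum_Icc_cyclic_shift hNx (Φhat t),
      sub_self]
  have hcouple : ∑ j ∈ Finset.Icc 1 N_x, ∫ x in X (j - 1)..X j, (Eh t j).eval x * (C 0 t j).eval x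
      = β * ∑ j ∈ Finset.Icc 1 N_x, (Φp t j - Φm t j) * (Ep t j - Em t j) := by
    let outflow : ℕ → ℝ := fun i => Ehat t i * Em t i - Em t i ^ 2 / 2
    have hcell : ∀ j ∈ Finset.Icc 1 N_x,
        ∫ x in X (j - 1)..X j, (Eh t j).eval x * (C 0 t j).eval x
        = outflow (if j = N_x then 1 else j + 1)
          - (Ehat t j * Ep t j - Ep t j ^ 2 / 2)
          + ρ₀ * ∫ x in X (j - 1)..X j, (Eh t j).eval x := fun j hj => by
      have h := hLDG2 t ht j hj (Eh t j) (hEdeg t j)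
      have hEm' : Em t (if j = N_x then 1 else j + 1) = (Eh t j).eval (X j) := by
        rw [hEm]
        rcases eq_or_ne j N_x with rfl | hne
        · simp
        · have : j ≠ 0 := by grind
          simp [hne, this]
      have hsplit : ∫ x in X (j - 1)..X j, ((C 0 t j).eval x - ρ₀) * (Eh t j).eval x
          = (∫ x in X (j - 1)..X j, (Eh t j).eval x * (C 0 t j).eval x)
            - ρ₀ * ∫ x in X (j - 1)..X j, (Eh t j).eval x := by
        rw [← intervalIntegral.integral_const_mul, ← intervalIntegral.integral_sub
          (Continuous.intervalIntegrable (by fun_prop) _ _)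
          (Continuous.intervalIntegrable (by fun_prop) _ _)]
        congr 1
        ext x
        ring
      rw [integral_eval_mul_eval_derivative, hsplit, ← hEm', ← hEp] at h
      simp only [outflow]
      linear_combination -h
    rw [Finset.sum_congr rfl hcell, Finset.sum_add_distrib, ← Finset.mul_sum, hE0,
      Finset.sum_sub_distrib, sum_Icc_cyclic_shift hNx outflow, mul_zero, add_zero,
      ← Finset.sum_sub_distrib, Finset.mul_sum]
    refine Finset.sum_congr rfl fun j _ => ?_
    simp only [outflow, hEhat]
    ring
  have hcell : ∀ j ∈ Finset.Icc 1 N_x,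
      HasDerivAt (fun τ => ∫ x in X (j - 1)..X j, (C 1 τ j).eval x / α τ)
        ((ghat 1 t j - ghat 1 t (if j = N_x then 1 else j + 1)) / α t
          + ∫ x in X (j - 1)..X j, (Eh t j).eval x * (C 0 t j).eval x) t := fun j hj => by
    have h := hDG 1 zero_le_one (by omega) j hj t ht 1 (by simp)
    simp only [Polynomial.derivative_one, Polynomial.eval_zero, Polynomial.eval_one, mul_zero,
      mul_one, intervalIntegral.integral_zero, Int.cast_one, sub_self, Real.sqrt_zero,
      Real.sqrt_one, zero_mul, add_zero, one_mul, neg_zero, zero_add] at h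
    simp only [intervalIntegral.integral_div]
    refine (h.fun_div (hαderiv t ht) hα0).congr_deriv ?_
    field_simp
    ring
  refine (HasDerivAt.fun_sum hcell).congr_deriv ?_
  rw [Finset.sum_add_distrib, ← Finset.sum_div, Finset.sum_sub_distrib,
    sum_Icc_cyclic_shift hNx (ghat 1 t), sub_self, zero_div, zero_add, hcouple]
end
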